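/- Let K be a field of characteristic 0, let 2 ≤ d ≤ N be integers, and let X be a d×N matrix over K of full rank d. Then X represents a regular matroid if and only if for every subset A₂ of the column indices with |A₂| = d−2 and every subset A₁ of the remaining column indices with |A₁| = 4, the product over all six 2-element subsets {i,j} of A₁ of the maximal minors Δ_{A₂ ∪ {i,j}}(X) is equal to 0. -/

import Mathlib

/-- The maximal minor of a `d × N` matrix indexed by a `d`-element set `I` of column
indices: the determinant of the square submatrix consisting of the columns in `I`
(taken in increasing order). Junk value `0` if `I.card ≠ d`. -/
noncomputable def maxMinor {K : Type*} [CommRing K] {d N : ℕ}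
    (X : Matrix (Fin d) (Fin N) K) (I : Finset (Fin N)) : K :=
  if h : I.card = d then
    (X.submatrix id (fun j : Fin d => ((I.orderIsoOfFin h) j).val)).det
  else 0

/-- A matrix is totally unimodular if every square submatrix has determinant `0`, `1` or `-1`. -/
def IsTotUnimod {K : Type*} [CommRing K] {d N : ℕ} (A : Matrix (Fin d) (Fin N) K) : Prop :=
  ∀ (k : ℕ) (f : Fin k → Fin d) (g : Fin k → Fin N), Function.Injective f → Function.Injective g →
    (A.submatrix f g).det = 0 ∨ (A.submatrix f g).det = 1 ∨ (A.submatrix f g).det = -1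

/-- A `d × N` matrix of full rank `d` represents a regular matroid if there is a totally
unimodular matrix with the same pattern of vanishing maximal minors. -/
def RepresentsRegular {K : Type*} [CommRing K] {d N : ℕ} (X : Matrix (Fin d) (Fin N) K) : Prop :=
  ∃ A : Matrix (Fin d) (Fin N) K, IsTotUnimod A ∧
    ∀ I : Finset (Fin N), I.card = d → (maxMinor X I = 0 ↔ maxMinor A I = 0)

section Helpers

set_option linter.unusedSectionVars false
set_option linter.unusedSimpArgs false

open Function

variable {K : Type*} [Field K] {d N : ℕ}

/-- Minor along a column selection function. -/
def mnr (Y : Matrix (Fin d) (Fin N) K) (f : Fin d → Fin N) : K := (Y.submatrix id f).det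

def upd2 (t : Fin d → Fin N) (i j : Fin d) (a b : Fin N) : Fin d → Fin N :=
  update (update t i a) j b

def NoU (Y : Matrix (Fin d) (Fin N) K) : Prop :=
  ∀ (t : Fin d → Fin N) (i j : Fin d), i ≠ j → ∀ a b c e : Fin N,
    mnr Y (upd2 t i j a b) = 0 ∨ mnr Y (upd2 t i j a c) = 0 ∨ mnr Y (upd2 t i j a e) = 0 ∨
    mnr Y (upd2 t i j b c) = 0 ∨ mnr Y (upd2 t i j b e) = 0 ∨ mnr Y (upd2 t i j c e) = 0

def pm (x : K) : Prop := x = 0 ∨ x = 1 ∨ x = -1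

lemma pm_mul {x y : K} (hx : pm x) (hy : pm y) : pm (x * y) := by
  unfold pm at *
  rcases hx with rfl | rfl | rfl <;> rcases hy with rfl | rfl | rfl <;> simp

lemma pm_neg {x : K} (hx : pm x) : pm (-x) := by
  unfold pm at *
  rcases hx with rfl | rfl | rfl <;> simp

lemma pm_div {x y : K} (hx : pm x) (hy : pm y) : pm (x / y) := by
  unfold pm at *
  rcases hx with rfl | rfl | rfl <;> rcases hy with rfl | rfl | rfl <;> simp

lemma submatrix_update (Y : Matrix (Fin d) (Fin N) K) (f : Fin d → Fin N) (i : Fin d) (a : Fin N) :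
    Y.submatrix id (update f i a) = (Y.submatrix id f).updateCol i (fun r => Y r a) := by
  ext r k
  by_cases h : k = i
  · subst h; simp
  · simp [h]

lemma mnr_zero_of_not_inj (Y : Matrix (Fin d) (Fin N) K) {f : Fin d → Fin N} {i j : Fin d}
    (hij : i ≠ j) (h : f i = f j) : mnr Y f = 0 := by
  apply Matrix.det_zero_of_column_eq hij
  intro k; simp [h]

lemma mnr_perm (Y : Matrix (Fin d) (Fin N) K) (f : Fin d → Fin N) (σ : Equiv.Perm (Fin d)) :
    mnr Y (f ∘ σ) = mnr Y f ∨ mnr Y (f ∘ σ) = - mnr Y f := by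
  have : mnr Y (f ∘ σ) = (Equiv.Perm.sign σ : ℤ) * mnr Y f := by
    have := Matrix.det_permute' σ (Y.submatrix id f)
    simpa [mnr, Matrix.submatrix_submatrix] using this
  rw [this]
  rcases Int.units_eq_one_or (Equiv.Perm.sign σ) with h | h <;> simp [h]

lemma mnr_swap (Y : Matrix (Fin d) (Fin N) K) (t : Fin d → Fin N) {i j : Fin d} (hij : i ≠ j)
    (a b : Fin N) : mnr Y (upd2 t i j b a) = - mnr Y (upd2 t i j a b) := by
  have h1 : upd2 t i j b a = upd2 t i j a b ∘ Equiv.swap i j := by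
    ext k
    by_cases h : k = j
    · subst h; simp [upd2, hij]
    by_cases h' : k = i
    · subst h'; simp [upd2, h]
    · simp [upd2, h, h', Equiv.swap_apply_of_ne_of_ne]
  have := Matrix.det_permute' (Equiv.swap i j) (Y.submatrix id (upd2 t i j a b))
  rw [Equiv.Perm.sign_swap hij] at this
  rw [h1]
  simpa [mnr, Matrix.submatrix_submatrix] using this

lemma plucker (Y : Matrix (Fin d) (Fin N) K) (t : Fin d → Fin N) {i j : Fin d} (hij : i ≠ j)
    (a b c e : Fin N) :
    mnr Y (upd2 t i j a b) * mnr Y (upd2 t i j c e) =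
      mnr Y (upd2 t i j c b) * mnr Y (upd2 t i j a e)
      + mnr Y (upd2 t i j a c) * mnr Y (upd2 t i j b e) := by
  have key := Matrix.mulVec_cramer (Y.submatrix id (upd2 t i j a b)) (fun r => Y r c)
  set M := Y.submatrix id (upd2 t i j a b) with hM
  -- the linear functional v ↦ det of M with column j := e, column i := v
  let L := (M.updateCol j (fun r => Y r e)).cramer
  have hL : ∀ x, L (fun r => Y r x) i = mnr Y (upd2 t i j x e) := by
    intro x
    simp only [L, Matrix.cramer_apply, mnr]
    congr 1
    ext r k
    by_cases h : k = i
    · subst h; simp [upd2, hij]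
    by_cases h' : k = j
    · subst h'; simp [upd2, Matrix.updateCol_apply, h]
    · simp [upd2, Matrix.updateCol_apply, hM, h, h']
  have h2 := congrArg (fun v => L v i) key
  have h3 : M.mulVec (M.cramer (fun r => Y r c)) =
      ∑ k, (M.cramer (fun r => Y r c)) k • (fun r => Y r (upd2 t i j a b k)) := by
    ext r
    simp [Matrix.mulVec, dotProduct, hM, mul_comm]
  simp only [h3, map_sum, map_smul, Finset.sum_apply, Pi.smul_apply, smul_eq_mul, hL] at h2
  rw [← Finset.sum_subset (Finset.subset_univ {i, j}), Finset.sum_pair hij] at h2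
  · have e1 : M.cramer (fun r => Y r c) i = mnr Y (upd2 t i j c b) := by
      simp only [Matrix.cramer_apply, mnr]
      rw [hM, ← submatrix_update]
      congr 2
      ext k
      by_cases h : k = i
      · subst h; simp [upd2, hij]
      by_cases h' : k = j
      · subst h'; simp [upd2, h]
      · simp [upd2, h, h']
    have e2 : M.cramer (fun r => Y r c) j = mnr Y (upd2 t i j a c) := by
      simp only [Matrix.cramer_apply, mnr]
      rw [hM, ← submatrix_update]
      simp [upd2]
    have e3 : upd2 t i j a b i = a := by simp [upd2, hij]
    have e4 : upd2 t i j a b j = b := by simp [upd2]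
    rw [e1, e2, e3, e4] at h2
    rw [h2]; rfl
  · intro k _ hk
    simp only [Finset.mem_insert, Finset.mem_singleton, not_or] at hk
    rw [mnr_zero_of_not_inj Y (i := k) (j := i) hk.1, mul_zero]
    simp [upd2, hk.1, hk.2, hij]

lemma NoU.transfer {Y Z : Matrix (Fin d) (Fin N) K} (h : NoU Y)
    (hYZ : ∀ f, mnr Y f = 0 → mnr Z f = 0) : NoU Z := by
  intro t i j hij a b c e
  have := h t i j hij a b c e
  grind

lemma mnr_unit {Y : Matrix (Fin d) (Fin N) K} {b : Fin d → Fin N} (hb : Y.submatrix id b = 1)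
    (r : Fin d) (c : Fin N) : mnr Y (update b r c) = Y r c := by
  rw [mnr, submatrix_update, hb, ← Matrix.cramer_apply, Matrix.cramer_one]; rfl

lemma noU_two {Y : Matrix (Fin d) (Fin N) K} {b : Fin d → Fin N} (hb : Y.submatrix id b = 1)
    (hY : NoU Y) {i j : Fin d} {x y : Fin N} (h1 : Y i x ≠ 0) (h2 : Y i y ≠ 0)
    (h3 : Y j x ≠ 0) (h4 : Y j y ≠ 0) : Y i x * Y j y = Y i y * Y j x := by
  by_cases hij : i = j
  · subst hij; ring
  have q0 : mnr Y (upd2 b i j (b i) (b j)) = 1 := by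
    simp [upd2, mnr, hb]
  have q1 : ∀ c, mnr Y (upd2 b i j (b i) c) = Y j c := by
    intro c; simp only [upd2, update_eq_self]; exact mnr_unit hb j c
  have q2 : ∀ c, mnr Y (upd2 b i j c (b j)) = Y i c := by
    intro c
    rw [← mnr_unit hb i c]
    congr 1
    ext k
    by_cases h : k = j
    · subst h; simp [upd2, Ne.symm hij]
    · simp [upd2, h]
  have q3 : ∀ c, mnr Y (upd2 b i j (b j) c) = - Y i c := by
    intro c; rw [mnr_swap Y b hij, q2]
  have q4 := plucker Y b hij (b i) (b j) x y
  rw [q0, q1, q1, q2, q3] at q4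
  have := hY b i j hij (b i) (b j) x y
  rw [q0, q1, q1, q3, q3] at this
  simp [h1, h2, h3, h4] at this
  rw [this] at q4
  linear_combination -q4

def pvt (Y : Matrix (Fin d) (Fin N) K) (r : Fin d) (c : Fin N) : Matrix (Fin d) (Fin N) K :=
  fun i x => if i = r then Y r x / Y r c else Y i x - Y i c * Y r x / Y r c

lemma pvt_mul {Y : Matrix (Fin d) (Fin N) K} {b : Fin d → Fin N} (hb : Y.submatrix id b = 1)
    {r : Fin d} {c : Fin N} (h : Y r c ≠ 0) :
    Y.submatrix id (update b r c) * pvt Y r c = Y := by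
  rw [submatrix_update, hb]
  ext i x
  rw [Matrix.mul_apply]
  have : ∀ k, (Matrix.updateCol (1 : Matrix (Fin d) (Fin d) K) r (fun r => Y r c)) i k * pvt Y r c k x
      = (if k = r then Y i c * Y r x / Y r c else 0) +
        (if k = i then (if i = r then 0 else Y i x - Y i c * Y r x / Y r c) else 0) := by
    intro k
    by_cases h1 : k = r
    · subst h1
      by_cases h2 : k = i
      · subst h2; simp [pvt, mul_div_assoc]
      · simp [pvt, h2, mul_div_assoc]
    · by_cases h2 : k = i
      · subst h2; simp [pvt, h1, Matrix.updateCol_apply]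
      · simp [pvt, h1, h2, Matrix.updateCol_apply, Matrix.one_apply, Ne.symm h2]
  simp only [this, Finset.sum_add_distrib, Finset.sum_ite_eq', Finset.mem_univ, if_true]
  by_cases h2 : i = r
  · subst h2; simp; field_simp
  · simp [h2]

lemma pvt_unit {Y : Matrix (Fin d) (Fin N) K} {b : Fin d → Fin N} (hb : Y.submatrix id b = 1)
    {r : Fin d} {c : Fin N} (h : Y r c ≠ 0) :
    (pvt Y r c).submatrix id (update b r c) = 1 := by
  ext i k
  have hb' : ∀ i k, Y i (b k) = (1 : Matrix (Fin d) (Fin d) K) i k := by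
    intro i k; rw [← hb]; rfl
  by_cases h1 : k = r
  · subst h1
    by_cases h2 : i = k
    · subst h2; simp [pvt, h]
    · simp [pvt, h2, h]
  · by_cases h2 : i = r
    · subst h2; simp [pvt, h1, hb', Matrix.one_apply, Ne.symm h1]
    · simp [pvt, h1, h2, hb', Matrix.one_apply, Ne.symm h1]

lemma mnr_mul (M : Matrix (Fin d) (Fin d) K) (Z : Matrix (Fin d) (Fin N) K) (f : Fin d → Fin N) :
    mnr (M * Z) f = M.det * mnr Z f := by
  rw [mnr, mnr, ← Matrix.det_mul]; rfl

lemma mnr_pvt {Y : Matrix (Fin d) (Fin N) K} {b : Fin d → Fin N} (hb : Y.submatrix id b = 1)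
    {r : Fin d} {c : Fin N} (h : Y r c ≠ 0) (f : Fin d → Fin N) :
    mnr Y f = Y r c * mnr (pvt Y r c) f := by
  conv_lhs => rw [← pvt_mul hb h, mnr_mul]
  congr 1
  exact mnr_unit hb r c

lemma pvt_noU {Y : Matrix (Fin d) (Fin N) K} {b : Fin d → Fin N} (hb : Y.submatrix id b = 1)
    (hY : NoU Y) {r : Fin d} {c : Fin N} (h : Y r c ≠ 0) : NoU (pvt Y r c) := by
  apply hY.transfer
  intro f hf
  rw [mnr_pvt hb h] at hf
  simpa [h] using hf

lemma pvt_pm {Y : Matrix (Fin d) (Fin N) K} {b : Fin d → Fin N} (hb : Y.submatrix id b = 1)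
    (hY : NoU Y) {r : Fin d} {c : Fin N} (h : Y r c ≠ 0) {x : Fin N}
    (hc : ∀ i, pm (Y i c)) (hx : ∀ i, pm (Y i x)) (i : Fin d) : pm (pvt Y r c i x) := by
  unfold pvt
  split_ifs with h1
  · exact pm_div (hx r) (hc r)
  · by_cases h2 : Y i x = 0
    · rw [h2, zero_sub]; exact pm_neg (pm_div (pm_mul (hc i) (hx r)) (hc r))
    by_cases h3 : Y i c = 0
    · simpa [h3] using hx i
    by_cases h4 : Y r x = 0
    · simpa [h4] using hx i
    left
    have := noU_two hb hY h3 h2 h h4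
    field_simp
    linear_combination - this

lemma mnr_pm_aux (n : ℕ) : ∀ (Y : Matrix (Fin d) (Fin N) K) (b f : Fin d → Fin N),
    Y.submatrix id b = 1 → NoU Y → (∀ i x, pm (Y i x)) →
    (Finset.univ.filter (fun k => f k ≠ b k)).card = n → pm (mnr Y f) := by
  induction n using Nat.strong_induction_on with
  | _ n ih =>
  intro Y b f hb hY hpm hn
  by_cases hf : f = b
  · subst hf; right; left; simp [mnr, hb]
  obtain ⟨k, hk⟩ := Function.ne_iff.mp hf
  have hb' : ∀ i k, Y i (b k) = (1 : Matrix (Fin d) (Fin d) K) i k := by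
    intro i k; rw [← hb]; rfl
  by_cases hr : ∃ r, f r ≠ b r ∧ Y r (f k) ≠ 0
  · obtain ⟨r, hr1, hr2⟩ := hr
    have hlt : (Finset.univ.filter
        (fun s => (f ∘ Equiv.swap r k) s ≠ (update b r (f k)) s)).card < n := by
      rw [← hn]
      apply Finset.card_lt_card
      rw [Finset.ssubset_iff_of_subset]
      · exact ⟨r, by simpa using hr1, by simp⟩
      · intro s hs
        simp only [Finset.mem_filter, Finset.mem_univ, true_and] at hs ⊢
        by_cases h1 : s = r
        · subst h1; exact hr1
        by_cases h2 : s = k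
        · subst h2; exact hk
        · simpa [h1, Equiv.swap_apply_of_ne_of_ne h1 h2] using hs
    have h1 := ih _ hlt (pvt Y r (f k)) (update b r (f k)) (f ∘ Equiv.swap r k)
      (pvt_unit hb hr2) (pvt_noU hb hY hr2)
      (fun i x => pvt_pm hb hY hr2 (fun i => hpm i _) (fun i => hpm i _) i) rfl
    rw [mnr_pvt hb hr2]
    apply pm_mul (hpm _ _)
    rcases mnr_perm (pvt Y r (f k)) f (Equiv.swap r k) with h | h
    · rwa [h] at h1
    · rw [h] at h1; simpa using pm_neg h1
  · left
    push Not at hr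
    rw [mnr, ← Matrix.exists_mulVec_eq_zero_iff]
    refine ⟨fun s => (if s = k then 1 else 0) - (if f s = b s then Y s (f k) else 0), ?_, ?_⟩
    · intro h
      have := congrFun h k
      simp [hk] at this
    · ext i
      simp only [Matrix.mulVec, dotProduct, mul_sub, Finset.sum_sub_distrib, Matrix.submatrix_apply,
        id, mul_ite, mul_one, mul_zero, Finset.sum_ite_eq', Finset.mem_univ, if_true, Pi.zero_apply]
      have : ∀ s, (if f s = b s then Y i (f s) * Y s (f k) else 0) =
          if s = i then Y i (f k) else 0 := by
        intro s
        by_cases h1 : s = i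
        · subst h1
          by_cases h2 : f s = b s
          · simp [h2, hb']
          · simp [h2, hr s h2]
        · by_cases h2 : f s = b s
          · simp [h2, hb', h1, Matrix.one_apply, Ne.symm h1]
          · simp [h2, h1]
      simp [this]

lemma mnr_pm {Y : Matrix (Fin d) (Fin N) K} {b : Fin d → Fin N} (hb : Y.submatrix id b = 1)
    (hY : NoU Y) (hpm : ∀ i x, pm (Y i x)) (f : Fin d → Fin N) : pm (mnr Y f) :=
  mnr_pm_aux _ Y b f hb hY hpm rfl

lemma totUnimod_of_pm {Y : Matrix (Fin d) (Fin N) K} {b : Fin d → Fin N}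
    (hb : Y.submatrix id b = 1) (h : ∀ f, pm (mnr Y f)) : IsTotUnimod Y := by
  classical
  intro k f g hf hg
  have hb' : ∀ i k, Y i (b k) = (1 : Matrix (Fin d) (Fin d) K) i k := by
    intro i k; rw [← hb]; rfl
  let p : Fin d → Prop := fun i => i ∉ Set.range f
  let hh : Fin d → Fin N := fun i => if hi : i ∈ Set.range f then g hi.choose else b i
  have hhf : ∀ s, hh (f s) = g s := by
    intro s
    have hi : f s ∈ Set.range f := ⟨s, rfl⟩
    simp only [hh, dif_pos hi]
    congr 1
    exact hf hi.choose_spec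
  have hhp : ∀ i, p i → hh i = b i := by
    intro i hi
    simp only [hh]
    rw [dif_neg hi]
  have h1 := Matrix.twoBlockTriangular_det (Y.submatrix id hh) p (by
    intro i hi j hj
    have : i ≠ j := by rintro rfl; exact hi hj
    simp [hhp j hj, hb', Matrix.one_apply, this])
  have h2 : (Y.submatrix id hh).toSquareBlockProp p = 1 := by
    ext i j
    simp [Matrix.toSquareBlockProp, Matrix.toBlock, hhp j j.2, hb', Matrix.one_apply, Subtype.ext_iff]
  let e : Fin k ≃ {i // ¬ p i} := Equiv.ofBijective (fun s => ⟨f s, by simp [p]⟩) (by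
    constructor
    · intro s s' hs; exact hf (by simpa using hs)
    · rintro ⟨i, hi⟩
      simp only [p, not_not] at hi
      obtain ⟨s, rfl⟩ := hi
      exact ⟨s, rfl⟩)
  have h3 : (Y.submatrix f g) =
      ((Y.submatrix id hh).toSquareBlockProp (fun i => ¬ p i)).submatrix e e := by
    ext s s'
    have he : ∀ s, ((e s : {i // ¬ p i}) : Fin d) = f s := fun s => rfl
    simp [Matrix.toSquareBlockProp, Matrix.toBlock, he, hhf]
  rw [h2, Matrix.det_one, one_mul] at h1
  rw [h3, Matrix.det_submatrix_equiv_self, ← h1]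
  exact h hh

def adjR (Y : Matrix (Fin d) (Fin N) K) (S : Finset (Fin N)) (i j : Fin d) : Prop :=
  ∃ x ∈ S, Y i x ≠ 0 ∧ Y j x ≠ 0

def eqpm (x y : K) : Prop := x = y ∨ x = -y

lemma eqpm.trans {x y z : K} (h : eqpm x y) (h' : eqpm y z) : eqpm x z := by
  unfold eqpm at *
  rcases h with rfl | rfl <;> rcases h' with rfl | rfl <;> simp

lemma eqpm.mul {x y z w : K} (h : eqpm x y) (h' : eqpm z w) : eqpm (x * z) (y * w) := by
  unfold eqpm at *
  rcases h with rfl | rfl <;> rcases h' with rfl | rfl <;> simp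

lemma eqpm.inv {x y : K} (h : eqpm x y) : eqpm x⁻¹ y⁻¹ := by
  unfold eqpm at *
  rcases h with rfl | rfl <;> simp

lemma eqpm_of_pm {x y : K} (hx : pm x) (hy : pm y) (hx0 : x ≠ 0) (hy0 : y ≠ 0) : eqpm x y := by
  unfold eqpm pm at *
  rcases hx with rfl | rfl | rfl <;> rcases hy with rfl | rfl | rfl <;> simp_all

lemma eqpm_adj {Y : Matrix (Fin d) (Fin N) K} {b : Fin d → Fin N} (hb : Y.submatrix id b = 1)
    (hY : NoU Y) {S : Finset (Fin N)} (hS : ∀ x ∈ S, ∀ i, pm (Y i x)) {e : Fin N} {i j : Fin d}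
    (hi : Y i e ≠ 0) (hj : Y j e ≠ 0) (h : adjR Y S i j) : eqpm (Y i e) (Y j e) := by
  obtain ⟨x, hx, h1, h2⟩ := h
  have h3 := noU_two hb hY hi h1 hj h2
  have h4 := eqpm_of_pm (hS x hx i) (hS x hx j) h1 h2
  unfold eqpm at *
  rcases h4 with h4 | h4
  · left; rw [h4] at h3; apply mul_right_cancel₀ h2; linear_combination h3
  · right; rw [h4] at h3; apply mul_right_cancel₀ h2; linear_combination h3

lemma eqpm_path (n : ℕ) : ∀ (Y : Matrix (Fin d) (Fin N) K) (b : Fin d → Fin N)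
    (S : Finset (Fin N)) (e : Fin N) (r : ℕ → Fin d),
    Y.submatrix id b = 1 → NoU Y → (∀ x ∈ S, ∀ i, pm (Y i x)) →
    (∀ k < n, adjR Y S (r k) (r (k + 1))) → Y (r 0) e ≠ 0 → Y (r n) e ≠ 0 →
    eqpm (Y (r 0) e) (Y (r n) e) := by
  induction n using Nat.strong_induction_on with
  | _ n ih =>
  intro Y b S e r hb hY hS hr h0 hn
  rcases Nat.lt_or_ge n 2 with hn2 | hn2
  · interval_cases n
    · left; rfl
    · exact eqpm_adj hb hY hS h0 hn (hr 0 (by norm_num))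
  obtain ⟨x, hx, hx0, hx1⟩ := hr 0 (by omega)
  rw [zero_add] at hx1
  by_cases h1 : Y (r 1) e = 0
  · by_cases hk : ∃ k, 2 ≤ k ∧ k ≤ n ∧ Y (r k) x ≠ 0
    · obtain ⟨k, hk2, hkn, hkx⟩ := hk
      have := ih (n - k + 1) (by omega) Y b S e (fun m => if m = 0 then r 0 else r (m + k - 1))
        hb hY hS (by
          intro m hm
          by_cases hm0 : m = 0
          · subst hm0
            have : 0 + 1 + k - 1 = k := by omega
            simp only [if_true, this]
            exact ⟨x, hx, hx0, by simpa using hkx⟩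
          · have := hr (m + k - 1) (by omega)
            have e1 : m + 1 + k - 1 = m + k - 1 + 1 := by omega
            simpa [hm0, e1] using this) (by simpa using h0) (by
          have e1 : n - k + 1 + k - 1 = n := by omega
          simpa [e1] using hn)
      have e1 : n - k + 1 + k - 1 = n := by omega
      simpa [e1] using this
    · push Not at hk
      have hne : ∀ k, 2 ≤ k → k ≤ n → r k ≠ r 1 := by
        intro k h2 h3 h4
        apply hx1; rw [← h4]; exact hk k h2 h3
      have h01 : r 0 ≠ r 1 := by
        intro h; rw [h] at h0; exact h0 h1
      have hZ : ∀ k, 2 ≤ k → k ≤ n → ∀ y, pvt Y (r 1) x (r k) y = Y (r k) y := by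
        intro k h2 h3 y
        simp [pvt, hne k h2 h3, hk k h2 h3]
      have hZ0 : pvt Y (r 1) x (r 0) e = Y (r 0) e := by
        simp [pvt, h01, h1]
      obtain ⟨y, hy, hy1, hy2⟩ := hr 1 (by omega)
      by_cases h02 : Y (r 0) y = 0
      · have := ih (n - 1) (by omega) (pvt Y (r 1) x) (update b (r 1) x) S e
          (fun m => if m = 0 then r 0 else r (m + 1))
          (pvt_unit hb hx1) (pvt_noU hb hY hx1)
          (fun y hy => pvt_pm hb hY hx1 (hS x hx) (hS y hy)) (by
            intro m hm
            by_cases hm0 : m = 0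
            · subst hm0
              refine ⟨y, hy, ?_, ?_⟩
              · simp [pvt, h01, h02, hx0, hx1, hy1]
              · simp only [zero_add, one_ne_zero, if_false]
                rw [hZ 2 le_rfl hn2]; exact hy2
            · obtain ⟨z, hz, hz1, hz2⟩ := hr (m + 1) (by omega)
              refine ⟨z, hz, ?_, ?_⟩
              · simp only [hm0, if_false]
                rw [hZ _ (by omega) (by omega)]; exact hz1
              · simp only [Nat.add_eq_zero_iff, one_ne_zero, and_false, if_false]
                rw [hZ _ (by omega) (by omega)]; exact hz2) (by
            simpa [hZ0] using h0) (by
            have e1 : n - 1 + 1 = n := by omega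
            have e2 : n - 1 ≠ 0 := by omega
            simp only [e2, if_false, e1]
            rw [hZ n hn2 le_rfl]; exact hn)
        have e1 : n - 1 + 1 = n := by omega
        have e2 : n - 1 ≠ 0 := by omega
        simp only [e2, if_false, if_true, e1] at this
        rwa [hZ n hn2 le_rfl, hZ0] at this
      · have := ih (n - 1) (by omega) Y b S e (fun m => if m = 0 then r 0 else r (m + 1))
          hb hY hS (by
            intro m hm
            by_cases hm0 : m = 0
            · subst hm0
              exact ⟨y, hy, by simpa using h02, by simpa using hy2⟩
            · simpa [hm0] using hr (m + 1) (by omega)) (by simpa using h0) (by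
            have e1 : n - 1 + 1 = n := by omega
            have e2 : n - 1 ≠ 0 := by omega
            simpa [e1, e2] using hn)
        have e1 : n - 1 + 1 = n := by omega
        have e2 : n - 1 ≠ 0 := by omega
        simpa [e1, e2] using this
  · have ha := eqpm_adj hb hY hS h0 h1 (hr 0 (by omega))
    have := ih (n - 1) (by omega) Y b S e (fun m => r (m + 1)) hb hY hS
      (fun m hm => hr (m + 1) (by omega)) (by simpa using h1) (by
        have e1 : n - 1 + 1 = n := by omega
        simpa [e1] using hn)
    have e1 : n - 1 + 1 = n := by omega
    simp only [e1, zero_add] at this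
    exact ha.trans this

lemma exists_path {α : Type*} {R : α → α → Prop} {a b : α} (h : Relation.ReflTransGen R a b) :
    ∃ (n : ℕ) (r : ℕ → α), r 0 = a ∧ r n = b ∧ ∀ k < n, R (r k) (r (k + 1)) := by
  induction h using Relation.ReflTransGen.head_induction_on with
  | refl => exact ⟨0, fun _ => b, rfl, rfl, by simp⟩
  | head h1 _ ih =>
    rename_i a c _
    obtain ⟨n, r, h0, hn, hr⟩ := ih
    refine ⟨n + 1, fun m => if m = 0 then a else r (m - 1), by simp, by simpa using hn, ?_⟩
    intro k hk
    by_cases hk0 : k = 0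
    · subst hk0; simpa [h0] using h1
    · have e1 : k - 1 + 1 = k := by omega
      have := hr (k - 1) (by omega)
      rw [e1] at this
      simpa [hk0] using this

lemma eqpm_conn {Y : Matrix (Fin d) (Fin N) K} {b : Fin d → Fin N} (hb : Y.submatrix id b = 1)
    (hY : NoU Y) {S : Finset (Fin N)} (hS : ∀ x ∈ S, ∀ i, pm (Y i x)) {e : Fin N} {i j : Fin d}
    (hi : Y i e ≠ 0) (hj : Y j e ≠ 0) (h : Relation.ReflTransGen (adjR Y S) i j) :
    eqpm (Y i e) (Y j e) := by
  obtain ⟨n, r, rfl, rfl, hr⟩ := exists_path h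
  exact eqpm_path n Y b S e r hb hY hS hr hi hj

/-- Row scaling `α` making each column in `S` proportional to a `0, ±1` vector. -/
def Scl (Y : Matrix (Fin d) (Fin N) K) (S : Finset (Fin N)) (α : Fin d → K) : Prop :=
  (∀ i, α i ≠ 0) ∧ ∀ x ∈ S, ∀ i j, Y i x ≠ 0 → Y j x ≠ 0 → eqpm (α i * Y i x) (α j * Y j x)

lemma rescale {Y : Matrix (Fin d) (Fin N) K} {b : Fin d → Fin N} (hb : Y.submatrix id b = 1)
    {S : Finset (Fin N)} {α : Fin d → K} (hα : Scl Y S α) :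
    ∃ β : Fin N → K, (∀ x, β x ≠ 0) ∧
      (Matrix.of fun i x => α i * Y i x * β x).submatrix id b = 1 ∧
      ∀ x ∈ S, ∀ i, pm (α i * Y i x * β x) := by
  classical
  have hb' : ∀ i k, Y i (b k) = (1 : Matrix (Fin d) (Fin d) K) i k := by
    intro i k; rw [← hb]; rfl
  have : ∀ x, ∃ β : K, β ≠ 0 ∧ ((∃ i, Y i x ≠ 0) → ∃ i, Y i x ≠ 0 ∧ α i * Y i x * β = 1) := by
    intro x
    by_cases h : ∃ i, Y i x ≠ 0
    · obtain ⟨i, hi⟩ := h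
      exact ⟨(α i * Y i x)⁻¹, inv_ne_zero (mul_ne_zero (hα.1 i) hi), fun _ =>
        ⟨i, hi, mul_inv_cancel₀ (mul_ne_zero (hα.1 i) hi)⟩⟩
    · exact ⟨1, one_ne_zero, fun h' => absurd h' h⟩
  choose β hβ0 hβ using this
  refine ⟨β, hβ0, ?_, ?_⟩
  · ext i k
    obtain ⟨j, hj, hj1⟩ := hβ (b k) ⟨k, by simp [hb']⟩
    have hjk : j = k := by
      by_contra hne; exact hj (by simp [hb', Matrix.one_apply, hne])
    subst hjk
    by_cases h : i = j
    · subst h; simpa using hj1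
    · simp [hb', h]
  · intro x hx i
    by_cases h : Y i x = 0
    · left; simp [h]
    · obtain ⟨j, hj, hj1⟩ := hβ x ⟨i, h⟩
      right
      have := (hα.2 x hx i j h hj).mul (Or.inl rfl : eqpm (β x) (β x))
      rwa [hj1] at this

lemma mnr_scale (Y : Matrix (Fin d) (Fin N) K) (α : Fin d → K) (β : Fin N → K)
    (f : Fin d → Fin N) :
    mnr (Matrix.of fun i x => α i * Y i x * β x) f = (∏ i, α i) * (∏ i, β (f i)) * mnr Y f := by
  have : (Matrix.of fun i x => α i * Y i x * β x).submatrix id f =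
      Matrix.diagonal α * Y.submatrix id f * Matrix.diagonal (fun i => β (f i)) := by
    ext i k; simp
  rw [mnr, this, Matrix.det_mul, Matrix.det_mul, Matrix.det_diagonal, Matrix.det_diagonal, mnr]
  ring

lemma noU_scale {Y : Matrix (Fin d) (Fin N) K} (hY : NoU Y) (α : Fin d → K) (β : Fin N → K) :
    NoU (Matrix.of fun i x => α i * Y i x * β x) :=
  hY.transfer (fun f hf => by rw [mnr_scale, hf, mul_zero])

lemma extend_one {Y : Matrix (Fin d) (Fin N) K} {b : Fin d → Fin N} (hb : Y.submatrix id b = 1)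
    (hY : NoU Y) {S : Finset (Fin N)} (hS : ∀ x ∈ S, ∀ i, pm (Y i x)) (e : Fin N) :
    ∃ α, Scl Y (insert e S) α := by
  classical
  have : ∀ i, ∃ a : K, a ≠ 0 ∧ ((∃ j, Relation.ReflTransGen (adjR Y S) i j ∧ Y j e ≠ 0) →
      ∃ j, Relation.ReflTransGen (adjR Y S) i j ∧ Y j e ≠ 0 ∧ a = (Y j e)⁻¹) ∧
      ((¬ ∃ j, Relation.ReflTransGen (adjR Y S) i j ∧ Y j e ≠ 0) → a = 1) := by
    intro i
    by_cases h : ∃ j, Relation.ReflTransGen (adjR Y S) i j ∧ Y j e ≠ 0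
    · obtain ⟨j, h1, h2⟩ := h
      exact ⟨(Y j e)⁻¹, inv_ne_zero h2, fun _ => ⟨j, h1, h2, rfl⟩, fun h => absurd ⟨j, h1, h2⟩ h⟩
    · exact ⟨1, one_ne_zero, fun h' => absurd h' h, fun _ => rfl⟩
  choose α h0 h1 h2 using this
  have hsym : ∀ {i j}, Relation.ReflTransGen (adjR Y S) i j →
      Relation.ReflTransGen (adjR Y S) j i := by
    intro i j h
    induction h with
    | refl => exact .refl
    | tail _ h2 ih =>
      obtain ⟨x, hx, ha, hb⟩ := h2
      exact .head ⟨x, hx, hb, ha⟩ ih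
  have hconn : ∀ i j, Relation.ReflTransGen (adjR Y S) i j → eqpm (α i) (α j) := by
    intro i j hij
    by_cases h : ∃ k, Relation.ReflTransGen (adjR Y S) i k ∧ Y k e ≠ 0
    · have h' : ∃ k, Relation.ReflTransGen (adjR Y S) j k ∧ Y k e ≠ 0 := by
        obtain ⟨k, hk, hk'⟩ := h
        exact ⟨k, (hsym hij).trans hk, hk'⟩
      obtain ⟨k, hk, hk0, hk1⟩ := h1 i h
      obtain ⟨l, hl, hl0, hl1⟩ := h1 j h'
      rw [hk1, hl1]
      exact (eqpm_conn hb hY hS hk0 hl0 ((hsym hk).trans (hij.trans hl))).inv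
    · have h' : ¬ ∃ k, Relation.ReflTransGen (adjR Y S) j k ∧ Y k e ≠ 0 := by
        rintro ⟨k, hk, hk'⟩
        exact h ⟨k, hij.trans hk, hk'⟩
      rw [h2 i h, h2 j h']; left; rfl
  refine ⟨α, h0, ?_⟩
  intro x hx i j hi hj
  by_cases hxS : x ∈ S
  · exact (hconn i j (.single ⟨x, hxS, hi, hj⟩)).mul
      (eqpm_of_pm (hS x hxS i) (hS x hxS j) hi hj)
  · have hxe : x = e := by
      rcases Finset.mem_insert.mp hx with h | h
      · exact h
      · exact absurd h hxS
    subst hxe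
    have key : ∀ i, Y i x ≠ 0 → eqpm (α i * Y i x) 1 ∧ eqpm 1 (α i * Y i x) := by
      intro i hi
      obtain ⟨k, hk, hk0, hk1⟩ := h1 i ⟨i, .refl, hi⟩
      have := eqpm_conn hb hY hS hi hk0 hk
      rw [hk1]
      rcases this with h | h
      · rw [h, inv_mul_cancel₀ hk0]; exact ⟨Or.inl rfl, Or.inl rfl⟩
      · rw [h, mul_neg, inv_mul_cancel₀ hk0]; exact ⟨Or.inr rfl, Or.inr (by simp)⟩
    exact (key i hi).1.trans (key j hj).2

lemma exists_scl {Y : Matrix (Fin d) (Fin N) K} {b : Fin d → Fin N} (hb : Y.submatrix id b = 1)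
    (hY : NoU Y) (S : Finset (Fin N)) : ∃ α, Scl Y S α := by
  classical
  induction S using Finset.induction_on with
  | empty => exact ⟨fun _ => 1, by simp [Scl]⟩
  | insert e S _ ih =>
    obtain ⟨α, hα⟩ := ih
    obtain ⟨β, hβ, hb1, hpm⟩ := rescale hb hα
    obtain ⟨α', hα'⟩ := extend_one hb1 (noU_scale hY α β) hpm e
    refine ⟨fun i => α' i * α i, fun i => mul_ne_zero (hα'.1 i) (hα.1 i), ?_⟩
    intro x hx i j hi hj
    have := hα'.2 x hx i j (by simp [hi, hα.1, hβ]) (by simp [hj, hα.1, hβ])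
    have := this.mul (Or.inl rfl : eqpm (β x)⁻¹ (β x)⁻¹)
    have hbx := hβ x
    simp only [Matrix.of_apply] at this
    convert this using 1 <;> field_simp

lemma mnr_maxMinor (X : Matrix (Fin d) (Fin N) K) {f : Fin d → Fin N} {I : Finset (Fin N)}
    (hI : I.card = d) (hf : Injective f) (hfI : ∀ k, f k ∈ I) :
    mnr X f = 0 ↔ maxMinor X I = 0 := by
  let g : Fin d → Fin d := fun k => (I.orderIsoOfFin hI).symm ⟨f k, hfI k⟩
  have hg : Injective g := by
    intro k l h
    have := (I.orderIsoOfFin hI).symm.injective h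
    exact hf (by simpa using this)
  let σ : Equiv.Perm (Fin d) := Equiv.ofBijective g (Finite.injective_iff_bijective.mp hg)
  have h1 : f = (fun j : Fin d => ((I.orderIsoOfFin hI) j).val) ∘ σ := by
    funext k
    have : (I.orderIsoOfFin hI) (g k) = ⟨f k, hfI k⟩ := (I.orderIsoOfFin hI).apply_symm_apply _
    change f k = ((I.orderIsoOfFin hI) (g k)).val
    rw [this]
  have h2 : maxMinor X I = mnr X (fun j : Fin d => ((I.orderIsoOfFin hI) j).val) := by
    rw [maxMinor, dif_pos hI]; rfl
  rw [h2]
  conv_lhs => rw [h1]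
  rcases mnr_perm X (fun j : Fin d => ((I.orderIsoOfFin hI) j).val) σ with h | h <;> rw [h]
  exact neg_eq_zero

lemma upd2_inj {t : Fin d → Fin N} {i j : Fin d} (hij : i ≠ j) {A : Finset (Fin N)}
    (ht : ∀ k, k ≠ i → k ≠ j → t k ∈ A)
    (hinj : ∀ k l, k ≠ i → k ≠ j → l ≠ i → l ≠ j → t k = t l → k = l) {x y : Fin N}
    (hxy : x ≠ y) (hx : x ∉ A) (hy : y ∉ A) :
    Injective (upd2 t i j x y) ∧ ∀ k, upd2 t i j x y k ∈ A ∪ {x, y} := by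
  have e1 : upd2 t i j x y i = x := by simp [upd2, hij]
  have e2 : upd2 t i j x y j = y := by simp [upd2]
  have e3 : ∀ k, k ≠ i → k ≠ j → upd2 t i j x y k = t k := by
    intro k h1 h2; simp [upd2, h1, h2]
  constructor
  · intro k l h
    by_cases k1 : k = i <;> by_cases k2 : k = j <;> by_cases l1 : l = i <;> by_cases l2 : l = j <;>
      grind
  · intro k
    by_cases k1 : k = i
    · subst k1; simp [e1]
    by_cases k2 : k = j
    · subst k2; simp [e2]
    rw [e3 k k1 k2]
    exact Finset.mem_union_left _ (ht k k1 k2)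

lemma exists_basis (X : Matrix (Fin d) (Fin N) K) (hX : X.rank = d) :
    ∃ b : Fin d → Fin N, (X.submatrix id b).det ≠ 0 := by
  rw [Matrix.rank_eq_finrank_span_cols] at hX
  obtain ⟨f, hf, _, hli⟩ := Submodule.exists_fun_fin_finrank_span_eq K (Set.range X.col)
  choose c hc using hf
  refine ⟨c ∘ finCongr hX.symm, ?_⟩
  have h1 : LinearIndependent K ((X.submatrix id (c ∘ finCongr hX.symm)).col) := by
    have h2 : (X.submatrix id (c ∘ finCongr hX.symm)).col = f ∘ finCongr hX.symm := by
      funext k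
      rw [comp_apply, ← hc]; rfl
    rw [h2]
    exact hli.comp _ (finCongr hX.symm).injective
  rw [Matrix.linearIndependent_cols_iff_isUnit, Matrix.isUnit_iff_isUnit_det] at h1
  exact h1.ne_zero

lemma noU_of_products (hd : 2 ≤ d) {X : Matrix (Fin d) (Fin N) K}
    (h : ∀ A₂ : Finset (Fin N), A₂.card = d - 2 →
      ∀ A₁ : Finset (Fin N), Disjoint A₁ A₂ → A₁.card = 4 →
        ∏ P ∈ A₁.powersetCard 2, maxMinor X (A₂ ∪ P) = 0) : NoU X := by
  classical
  intro t i j hij a b c e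
  by_contra hcon
  push Not at hcon
  obtain ⟨hab, hac, hae, hbc, hbe, hce⟩ := hcon
  -- vanishing facts
  have hne : ∀ x y, mnr X (upd2 t i j x y) ≠ 0 → x ≠ y := by
    intro x y hxy hh
    subst hh
    exact hxy (mnr_zero_of_not_inj X hij (by simp [upd2, hij]))
  have hinj : ∀ x y, mnr X (upd2 t i j x y) ≠ 0 → Injective (upd2 t i j x y) := by
    intro x y hxy k l hkl
    by_contra hk
    exact hxy (mnr_zero_of_not_inj X hk hkl)
  have hsw : ∀ x y, mnr X (upd2 t i j x y) ≠ 0 → mnr X (upd2 t i j y x) ≠ 0 := by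
    intro x y hxy
    rw [mnr_swap X t hij]; simpa using hxy
  set D : Finset (Fin d) := (Finset.univ.erase i).erase j with hD
  have hDm : ∀ k, k ∈ D ↔ k ≠ i ∧ k ≠ j := by intro k; simp [hD, and_comm]
  have htk : ∀ x y k, k ≠ i → k ≠ j → upd2 t i j x y k = t k := by
    intro x y k h1 h2; simp [upd2, h1, h2]
  have htinj : ∀ k l, k ≠ i → k ≠ j → l ≠ i → l ≠ j → t k = t l → k = l := by
    intro k l k1 k2 l1 l2 hkl
    apply hinj a b hab
    rw [htk _ _ k k1 k2, htk _ _ l l1 l2, hkl]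
  have hnot : ∀ x y, mnr X (upd2 t i j x y) ≠ 0 → x ∉ D.image t := by
    intro x y hxy hx
    obtain ⟨k, hk, hkx⟩ := Finset.mem_image.mp hx
    rw [hDm] at hk
    apply hk.1
    apply hinj x y hxy
    rw [htk _ _ k hk.1 hk.2, hkx]; simp [upd2, hij]
  have hcard : (D.image t).card = d - 2 := by
    rw [Finset.card_image_of_injOn]
    · rw [hD, Finset.card_erase_of_mem (by simp [Ne.symm hij]), Finset.card_erase_of_mem (by simp)]
      simp; omega
    · intro k hk l hl hkl
      have hk := (hDm k).mp hk
      have hl := (hDm l).mp hl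
      exact htinj k l hk.1 hk.2 hl.1 hl.2 hkl
  have ha' := hnot a b hab
  have hb' := hnot b c hbc
  have hc' := hnot c e hce
  have he' := hnot e c (hsw _ _ hce)
  have h4 : ({a, b, c, e} : Finset (Fin N)).card = 4 := by
    have := hne _ _ hab
    have := hne _ _ hac
    have := hne _ _ hae
    have := hne _ _ hbc
    have := hne _ _ hbe
    have := hne _ _ hce
    rw [Finset.card_insert_of_notMem, Finset.card_insert_of_notMem, Finset.card_pair] <;> simp [*]
  have hprod := h (D.image t) hcard {a, b, c, e} (by
    rw [Finset.disjoint_left]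
    intro x hx
    simp only [Finset.mem_insert, Finset.mem_singleton] at hx
    rcases hx with rfl | rfl | rfl | rfl <;> assumption) h4
  obtain ⟨P, hP, hP0⟩ := Finset.prod_eq_zero_iff.mp hprod
  rw [Finset.mem_powersetCard] at hP
  obtain ⟨hPs, hPc⟩ := hP
  obtain ⟨x, y, hxy, rfl⟩ := Finset.card_eq_two.mp hPc
  have hx : x ∈ ({a, b, c, e} : Finset (Fin N)) := hPs (by simp)
  have hy : y ∈ ({a, b, c, e} : Finset (Fin N)) := hPs (by simp)
  have hmn : mnr X (upd2 t i j x y) ≠ 0 := by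
    simp only [Finset.mem_insert, Finset.mem_singleton] at hx hy
    rcases hx with rfl | rfl | rfl | rfl <;> rcases hy with rfl | rfl | rfl | rfl <;>
      first
        | exact absurd rfl hxy
        | assumption
        | (apply hsw; assumption)
  have hi := upd2_inj hij (A := D.image t)
    (fun k h1 h2 => Finset.mem_image_of_mem _ ((hDm k).mpr ⟨h1, h2⟩)) htinj hxy
    (hnot _ _ hmn) (hnot _ _ (hsw _ _ hmn))
  apply hmn
  rw [mnr_maxMinor X (I := D.image t ∪ {x, y}) ?_ hi.1 hi.2, hP0]
  rw [Finset.card_union_of_disjoint, hcard, hPc]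
  · omega
  · rw [Finset.disjoint_right]
    intro z hz
    simp only [Finset.mem_insert, Finset.mem_singleton] at hz
    rcases hz with rfl | rfl
    · exact hnot _ _ hmn
    · exact hnot _ _ (hsw _ _ hmn)

lemma products_of_regular [CharZero K] (hd : 2 ≤ d) {X : Matrix (Fin d) (Fin N) K}
    (h : RepresentsRegular X) (A₂ : Finset (Fin N)) (hA₂ : A₂.card = d - 2)
    (A₁ : Finset (Fin N)) (hdis : Disjoint A₁ A₂) (hA₁ : A₁.card = 4) :
    ∏ P ∈ A₁.powersetCard 2, maxMinor X (A₂ ∪ P) = 0 := by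
  classical
  obtain ⟨A, hTU, hA⟩ := h
  by_contra hne
  rw [← ne_eq, Finset.prod_ne_zero_iff] at hne
  have hcard : ∀ x ∈ A₁, ∀ y ∈ A₁, x ≠ y → (A₂ ∪ {x, y}).card = d := by
    intro x hx y hy hxy
    rw [Finset.card_union_of_disjoint, hA₂, Finset.card_pair hxy]
    · omega
    · rw [Finset.disjoint_right]
      intro z hz
      simp only [Finset.mem_insert, Finset.mem_singleton] at hz
      rcases hz with rfl | rfl
      · exact Finset.disjoint_left.mp hdis hx
      · exact Finset.disjoint_left.mp hdis hy
  have hmm : ∀ x ∈ A₁, ∀ y ∈ A₁, x ≠ y → maxMinor A (A₂ ∪ {x, y}) ≠ 0 := by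
    intro x hx y hy hxy h0
    apply hne {x, y}
    · rw [Finset.mem_powersetCard]
      refine ⟨?_, Finset.card_pair hxy⟩
      intro z hz
      simp only [Finset.mem_insert, Finset.mem_singleton] at hz
      rcases hz with rfl | rfl <;> assumption
    · exact (hA _ (hcard x hx y hy hxy)).mpr h0
  obtain ⟨a, A', ha, rfl, hA'⟩ := Finset.card_eq_succ.mp hA₁
  obtain ⟨b, c, e, hbc, hbe, hce, rfl⟩ := Finset.card_eq_three.mp hA'
  simp only [Finset.mem_insert, Finset.mem_singleton, not_or] at ha
  obtain ⟨hab, hac, hae⟩ := ha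
  set f : Fin d → Fin N :=
    fun k => ((A₂ ∪ {a, b}).orderIsoOfFin (hcard a (by simp) b (by simp) hab) k).val with hf
  have hfinj : Injective f := by
    intro k l hkl
    exact ((A₂ ∪ {a, b}).orderIsoOfFin _).injective (Subtype.ext hkl)
  have hfs : ∀ x ∈ A₂ ∪ {a, b}, ∃ k, f k = x := by
    intro x hx
    exact ⟨((A₂ ∪ {a, b}).orderIsoOfFin (hcard a (by simp) b (by simp) hab)).symm ⟨x, hx⟩,
      congrArg Subtype.val (OrderIso.apply_symm_apply _ _)⟩
  obtain ⟨i, hi⟩ := hfs a (by simp)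
  obtain ⟨j, hj⟩ := hfs b (by simp)
  have hij : i ≠ j := by rintro rfl; exact hab (hi.symm.trans hj)
  have hfA : ∀ k, k ≠ i → k ≠ j → f k ∈ A₂ := by
    intro k k1 k2
    have h1 : f k ∈ A₂ ∪ {a, b} := ((A₂ ∪ {a, b}).orderIsoOfFin _ k).2
    simp only [Finset.mem_union, Finset.mem_insert, Finset.mem_singleton] at h1
    rcases h1 with h1 | h1 | h1
    · exact h1
    · exact absurd (hfinj (h1.trans hi.symm)) k1
    · exact absurd (hfinj (h1.trans hj.symm)) k2
  have key : ∀ x ∈ insert a ({b, c, e} : Finset (Fin N)), ∀ y ∈ insert a ({b, c, e} : Finset (Fin N)),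
      x ≠ y → mnr A (upd2 f i j x y) = 1 ∨ mnr A (upd2 f i j x y) = -1 := by
    intro x hx y hy hxy
    have h1 := upd2_inj hij hfA (fun k l _ _ _ _ hkl => hfinj hkl) hxy
      (Finset.disjoint_left.mp hdis hx) (Finset.disjoint_left.mp hdis hy)
    have h2 := hTU d id _ injective_id h1.1
    have h3 := mnr_maxMinor A (hcard x hx y hy hxy) h1.1 h1.2
    rcases h2 with h2 | h2
    · exact absurd (h3.mp h2) (hmm x hx y hy hxy)
    · exact h2
  have hp := plucker A f hij a b c e
  have m2 : ∀ {x y : K}, (x = 1 ∨ x = -1) → (y = 1 ∨ y = -1) → (x * y = 1 ∨ x * y = -1) := by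
    rintro x y (rfl | rfl) (rfl | rfl) <;> simp
  have k1 := m2 (key a (by simp) b (by simp) hab) (key c (by simp) e (by simp) hce)
  have k2 := m2 (key c (by simp) b (by simp) hbc.symm) (key a (by simp) e (by simp) hae)
  have k3 := m2 (key a (by simp) c (by simp) hac) (key b (by simp) e (by simp) hbe)
  rcases k1 with k1 | k1 <;> rcases k2 with k2 | k2 <;> rcases k3 with k3 | k3 <;>
    rw [k1, k2, k3] at hp <;> norm_num at hp

lemma regular_of_noU {X : Matrix (Fin d) (Fin N) K} (hX : X.rank = d) (hU : NoU X) :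
    RepresentsRegular X := by
  obtain ⟨b, hb⟩ := exists_basis X hX
  set M := X.submatrix id b with hM
  have hu : IsUnit M.det := isUnit_iff_ne_zero.mpr hb
  have hY1 : (M⁻¹ * X).submatrix id b = 1 := by
    have : (M⁻¹ * X).submatrix id b = M⁻¹ * M := rfl
    rw [this, Matrix.nonsing_inv_mul _ hu]
  have hdet : (M⁻¹).det ≠ 0 := by
    rw [Matrix.det_nonsing_inv]; simpa using hb
  have hYU : NoU (M⁻¹ * X) := hU.transfer (fun f hf => by rw [mnr_mul, hf, mul_zero])
  obtain ⟨α, hα⟩ := exists_scl hY1 hYU Finset.univ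
  obtain ⟨β, hβ, hb1, hpm⟩ := rescale hY1 hα
  refine ⟨_, totUnimod_of_pm hb1 (mnr_pm hb1 (noU_scale hYU α β)
    (fun i x => hpm x (Finset.mem_univ _) i)), ?_⟩
  intro I hI
  have hinj : Injective (fun j : Fin d => ((I.orderIsoOfFin hI) j).val) := by
    intro k l hkl
    exact (I.orderIsoOfFin hI).injective (Subtype.ext hkl)
  rw [← mnr_maxMinor _ hI hinj (fun k => ((I.orderIsoOfFin hI) k).2),
    ← mnr_maxMinor _ hI hinj (fun k => ((I.orderIsoOfFin hI) k).2), mnr_scale, mnr_mul]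
  simp [hb, Finset.prod_eq_zero_iff, hα.1, hβ]

end Helpers


/-- **Proposition 3.3 (pointwise form).** Over a field of characteristic `0`, a full-rank
`d × N` matrix `X` represents a regular matroid iff for every `(d-2)`-element set `A₂` of
column indices and every `4`-element set `A₁` of the remaining column indices, the product
of the six maximal minors `Δ_{A₂ ∪ {i,j}}(X)`, over the `2`-element subsets `{i,j}` of
`A₁`, vanishes. -/
theorem regular_iff_U24_minor_products_vanish {K : Type*} [Field K] [CharZero K]
    (d N : ℕ) (hd : 2 ≤ d) (hdN : d ≤ N)
    (X : Matrix (Fin d) (Fin N) K) (hX : X.rank = d) :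
    RepresentsRegular X ↔
      ∀ A₂ : Finset (Fin N), A₂.card = d - 2 →
      ∀ A₁ : Finset (Fin N), Disjoint A₁ A₂ → A₁.card = 4 →
        ∏ P ∈ A₁.powersetCard 2, maxMinor X (A₂ ∪ P) = 0 := by
  exact ⟨fun h A₂ h2 A₁ h1 h4 => products_of_regular hd h A₂ h2 A₁ h1 h4,
    fun h => regular_of_noU hX (noU_of_products hd h)⟩
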